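/- arXiv:2603.20084 — 2 statements merged into one kernel-verified Lean document; each statement's English description precedes it below -/
import Mathlib

section
/- Every noncyclic group of order at most 27 whose order is a power of 3 admits a colouring bijection. -/
/-- A bijection `σ : G → G` is a *colouring bijection* if the three maps
`x ↦ σ(x)·x`, `x ↦ x⁻¹·σ(x)` and `x ↦ x⁻¹·σ(x)·x` are bijections of `G`. -/
def IsColouringBijection {G : Type*} [Group G] (σ : G → G) : Prop :=
  Function.Bijective σ ∧
    Function.Bijective (fun x => σ x * x) ∧
    Function.Bijective (fun x => x⁻¹ * σ x) ∧
    Function.Bijective (fun x => x⁻¹ * σ x * x)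

/-- Transport of a colouring bijection from a model on `{0, …, N-1}`. -/
theorem colouring_transport {G : Type*} [Group G] [Fintype G] (N : ℕ)
    (hN : Fintype.card G = N) (φ : ℕ → G) (m : ℕ → ℕ → ℕ) (iv s : ℕ → ℕ)
    (hφ : ∀ g, ∃ x < N, φ x = g)
    (hm : ∀ x y, φ (m x y) = φ x * φ y)
    (hiv : ∀ x < N, φ (iv x) = (φ x)⁻¹)
    (h1 : ∀ y < N, ∃ x < N, s x = y)
    (h2 : ∀ y < N, ∃ x < N, m (s x) x = y)
    (h3 : ∀ y < N, ∃ x < N, m (iv x) (s x) = y)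
    (h4 : ∀ y < N, ∃ x < N, m (m (iv x) (s x)) x = y) :
    ∃ σ : G → G, IsColouringBijection σ := by
  have hsurj : Function.Surjective (fun x : Fin N => φ x) := by
    intro g
    obtain ⟨x, hx, rfl⟩ := hφ g
    exact ⟨⟨x, hx⟩, rfl⟩
  have hbij : Function.Bijective (fun x : Fin N => φ x) :=
    (Fintype.bijective_iff_surjective_and_card _).2 ⟨hsurj, by simp [hN]⟩
  let e : Fin N ≃ G := Equiv.ofBijective _ hbij
  have key : ∀ x (hx : x < N), ((e.symm (φ x) : Fin N) : ℕ) = x := by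
    intro x hx
    have : e.symm (φ x) = ⟨x, hx⟩ := by
      rw [Equiv.symm_apply_eq]; rfl
    rw [this]
  have main : ∀ (f : ℕ → ℕ) (F : G → G), (∀ x < N, F (φ x) = φ (f x)) →
      (∀ y < N, ∃ x < N, f x = y) → Function.Bijective F := by
    intro f F hF hf
    rw [← Finite.surjective_iff_bijective]
    intro g
    obtain ⟨y, hy, rfl⟩ := hφ g
    obtain ⟨x, hx, rfl⟩ := hf y hy
    exact ⟨φ x, hF x hx⟩
  refine ⟨fun g => φ (s (e.symm g)), ?_, ?_, ?_, ?_⟩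
  · refine main s _ ?_ h1
    intro x hx
    simp only [key x hx]
  · refine main _ _ ?_ h2
    intro x hx
    simp only [key x hx, hm]
  · refine main _ _ ?_ h3
    intro x hx
    simp only [key x hx, hm, hiv x hx]
  · refine main _ _ ?_ h4
    intro x hx
    simp only [key x hx, hm, hiv x hx]

/-- `f` maps `{0, …, N-1}` onto a set containing `{0, …, N-1}`. -/
def onto (N : ℕ) (f : ℕ → ℕ) : Bool :=
  (List.range N).all fun y => (List.range N).any fun x => Nat.beq (f x) y

theorem onto_spec {N : ℕ} {f : ℕ → ℕ} (h : onto N f = true) :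
    ∀ y < N, ∃ x < N, f x = y := by
  intro y hy
  simp only [onto, List.all_eq_true, List.any_eq_true, List.mem_range, Nat.beq_eq] at h
  exact h y hy

/-- Code of the product of `a^i b^j c^k`'s (coded as `9 i + 3 j + k`), where
`a^3 = c^α`, `b^3 = c^β`, `b a = a b c^γ`, `c` central with `c^3 = 1`. -/
def mul27 (α β γ x y : ℕ) : ℕ :=
  9 * ((x / 9 + y / 9) % 3) + (3 * ((x / 3 % 3 + y / 3 % 3) % 3) +
    (x % 3 + y % 3 + γ * (x / 3 % 3) * (y / 9) + α * ((x / 9 + y / 9) / 3)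
      + β * ((x / 3 % 3 + y / 3 % 3) / 3)) % 3)

/-- Code of the inverse. -/
def inv27 (α β γ x : ℕ) : ℕ :=
  9 * ((3 - x / 9) % 3) + (3 * ((3 - x / 3 % 3) % 3) +
    2 * mul27 α β γ x (9 * ((3 - x / 9) % 3) + 3 * ((3 - x / 3 % 3) % 3)) % 3)

/-- Colouring bijections for the 27 presentations. -/
def tables27 : List (List ℕ) := [
  [0, 22, 6, 13, 9, 21, 11, 24, 7, 5, 1, 17, 19, 2, 23, 26, 12, 10, 3, 20, 16, 25, 8, 15, 18, 4, 14],
  [0, 8, 16, 22, 19, 12, 10, 3, 25, 4, 9, 24, 7, 2, 17, 20, 21, 14, 23, 13, 18, 11, 26, 5, 6, 1, 15],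
  [0, 26, 10, 16, 12, 8, 5, 24, 22, 13, 4, 17, 14, 20, 23, 19, 1, 6, 25, 21, 18, 2, 7, 11, 15, 3, 9],
  [0, 17, 12, 22, 8, 4, 21, 16, 26, 15, 11, 18, 1, 20, 7, 5, 10, 25, 3, 13, 24, 14, 6, 2, 19, 9, 23],
  [0, 21, 15, 11, 24, 14, 8, 5, 20, 2, 17, 22, 26, 10, 12, 7, 19, 3, 1, 16, 23, 25, 13, 9, 18, 6, 4],
  [0, 22, 8, 19, 11, 13, 3, 25, 9, 10, 24, 21, 2, 15, 23, 14, 5, 6, 20, 7, 12, 4, 16, 26, 17, 18, 1],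
  [0, 5, 8, 15, 24, 19, 10, 23, 16, 22, 26, 1, 20, 14, 11, 2, 7, 9, 21, 18, 25, 4, 17, 12, 6, 13, 3],
  [0, 12, 25, 11, 21, 26, 16, 5, 7, 6, 22, 13, 3, 17, 20, 14, 18, 1, 19, 9, 15, 24, 2, 4, 8, 10, 23],
  [0, 15, 22, 5, 14, 16, 23, 26, 6, 4, 25, 18, 20, 9, 2, 10, 7, 12, 17, 13, 11, 24, 3, 8, 21, 19, 1],
  [0, 16, 7, 4, 23, 26, 9, 24, 13, 11, 20, 15, 2, 21, 8, 10, 25, 3, 5, 12, 22, 6, 19, 1, 18, 17, 14],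
  [0, 14, 25, 18, 21, 6, 10, 3, 15, 12, 1, 24, 22, 19, 8, 11, 17, 4, 2, 13, 26, 23, 20, 7, 9, 16, 5],
  [0, 23, 17, 4, 10, 13, 26, 6, 19, 7, 18, 25, 21, 16, 2, 11, 3, 12, 9, 5, 14, 20, 8, 24, 1, 22, 15],
  [0, 11, 26, 6, 9, 2, 25, 20, 10, 23, 4, 8, 24, 21, 16, 13, 7, 15, 17, 12, 19, 1, 14, 3, 5, 18, 22],
  [0, 19, 9, 7, 23, 12, 16, 18, 4, 14, 26, 22, 13, 20, 17, 6, 2, 5, 15, 25, 3, 11, 1, 8, 21, 24, 10],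
  [0, 6, 11, 26, 14, 21, 18, 5, 16, 25, 22, 12, 17, 4, 19, 10, 1, 7, 20, 3, 15, 8, 2, 9, 23, 13, 24],
  [0, 11, 3, 9, 13, 1, 22, 25, 19, 16, 4, 7, 17, 24, 2, 20, 14, 21, 5, 18, 6, 12, 23, 26, 10, 15, 8],
  [0, 13, 26, 8, 9, 4, 16, 20, 21, 25, 1, 14, 10, 5, 7, 22, 18, 15, 24, 2, 12, 3, 11, 6, 17, 19, 23],
  [0, 10, 3, 8, 15, 26, 19, 13, 21, 12, 18, 22, 2, 5, 11, 6, 17, 25, 24, 16, 7, 23, 20, 14, 9, 4, 1],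
  [0, 18, 16, 7, 1, 9, 15, 19, 21, 24, 12, 6, 22, 3, 25, 17, 14, 8, 13, 20, 4, 11, 5, 26, 23, 10, 2],
  [0, 15, 25, 17, 26, 2, 1, 24, 16, 14, 20, 8, 7, 18, 13, 6, 12, 19, 21, 5, 9, 22, 11, 4, 10, 23, 3],
  [0, 20, 12, 1, 13, 19, 2, 18, 14, 11, 4, 26, 25, 9, 5, 3, 10, 24, 17, 23, 8, 22, 15, 6, 21, 16, 7],
  [0, 7, 15, 25, 17, 14, 18, 8, 21, 13, 3, 23, 22, 5, 10, 26, 6, 11, 9, 16, 19, 24, 1, 20, 2, 12, 4],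
  [0, 8, 19, 24, 20, 15, 4, 12, 17, 11, 21, 14, 7, 5, 1, 16, 23, 25, 26, 6, 22, 10, 3, 13, 9, 18, 2],
  [0, 26, 4, 19, 11, 16, 9, 8, 23, 3, 20, 17, 14, 6, 21, 2, 12, 18, 22, 10, 25, 24, 13, 1, 15, 7, 5],
  [0, 17, 22, 10, 15, 4, 20, 25, 3, 7, 11, 12, 23, 18, 1, 14, 8, 26, 9, 13, 16, 6, 24, 5, 21, 2, 19],
  [0, 4, 18, 13, 11, 16, 7, 26, 23, 15, 9, 12, 6, 22, 24, 2, 5, 20, 8, 21, 25, 1, 19, 3, 17, 10, 14],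
  [0, 23, 20, 12, 16, 2, 21, 1, 17, 25, 13, 4, 19, 14, 3, 10, 18, 5, 7, 11, 26, 9, 15, 6, 22, 24, 8]]

/-- The colouring bijection for the parameters `α, β, γ`. -/
def sig27 (α β γ x : ℕ) : ℕ := (tables27.getD (9 * α + 3 * β + γ) []).getD x 0

def check27 (α β γ : ℕ) : Bool :=
  let s := sig27 α β γ
  let m := mul27 α β γ
  let iv := inv27 α β γ
  (List.range 27).all (fun x => Nat.beq (m x (iv x)) 0) &&
  (onto 27 s && (onto 27 (fun x => m (s x) x) && (onto 27 (fun x => m (iv x) (s x)) &&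
    onto 27 (fun x => m (m (iv x) (s x)) x))))

theorem check27_all : ∀ α < 3, ∀ β < 3, ∀ γ < 3, check27 α β γ = true := by
  decide +kernel

theorem colouring27 {G : Type*} [Group G] [Fintype G] (hG : Fintype.card G = 27)
    (a b c : G) (α β γ : ℕ) (hα : α < 3) (hβ : β < 3) (hγ : γ < 3)
    (hc : ∀ g, c * g = g * c) (hc3 : c ^ 3 = 1) (ha : a ^ 3 = c ^ α) (hb : b ^ 3 = c ^ β)
    (hab : b * a = a * b * c ^ γ)
    (hgen : ∀ g, ∃ i < 3, ∃ j < 3, ∃ k < 3, g = a ^ i * b ^ j * c ^ k) :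
    ∃ σ : G → G, IsColouringBijection σ := by
  have hcc : ∀ g n, c ^ n * g = g * c ^ n := fun g n => (Commute.pow_left (hc g) n)
  have hmod : ∀ n, c ^ (n % 3) = c ^ n := by
    intro n
    conv_rhs => rw [← Nat.mod_add_div n 3, pow_add, pow_mul, hc3, one_pow, mul_one]
  have hamod : ∀ n, a ^ n = a ^ (n % 3) * c ^ (α * (n / 3)) := by
    intro n
    conv_lhs => rw [← Nat.mod_add_div n 3, pow_add, pow_mul, ha, ← pow_mul]
  have hbmod : ∀ n, b ^ n = b ^ (n % 3) * c ^ (β * (n / 3)) := by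
    intro n
    conv_lhs => rw [← Nat.mod_add_div n 3, pow_add, pow_mul, hb, ← pow_mul]
  have hba1 : ∀ j, b ^ j * a = a * b ^ j * c ^ (γ * j) := by
    intro j
    induction j with
    | zero => simp
    | succ j ih =>
      calc b ^ (j + 1) * a = b ^ j * (b * a) := by rw [pow_succ, mul_assoc]
        _ = (b ^ j * a) * (b * c ^ γ) := by rw [hab]; simp only [mul_assoc]
        _ = a * b ^ j * (c ^ (γ * j) * b) * c ^ γ := by rw [ih]; simp only [mul_assoc]
        _ = a * b ^ (j + 1) * c ^ (γ * (j + 1)) := by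
          rw [hcc, mul_add, mul_one, pow_add c, pow_succ b]; simp only [mul_assoc]
  have hba : ∀ j i, b ^ j * a ^ i = a ^ i * b ^ j * c ^ (γ * j * i) := by
    intro j i
    induction i with
    | zero => simp
    | succ i ih =>
      calc b ^ j * a ^ (i + 1) = (b ^ j * a ^ i) * a := by rw [pow_succ, mul_assoc]
        _ = a ^ i * b ^ j * (c ^ (γ * j * i) * a) := by rw [ih]; simp only [mul_assoc]
        _ = a ^ i * (b ^ j * a) * c ^ (γ * j * i) := by rw [hcc]; simp only [mul_assoc]
        _ = a ^ (i + 1) * b ^ j * (c ^ (γ * j) * c ^ (γ * j * i)) := by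
          rw [hba1, pow_succ]; simp only [mul_assoc]
        _ = _ := by rw [← pow_add]; congr 2; ring
  let φ : ℕ → G := fun x => a ^ (x / 9) * b ^ (x / 3 % 3) * c ^ (x % 3)
  have hφ : ∀ i j k, j < 3 → k < 3 → φ (9 * i + (3 * j + k)) = a ^ i * b ^ j * c ^ k := by
    intro i j k hj hk
    have e1 : (9 * i + (3 * j + k)) / 9 = i := by omega
    have e2 : (9 * i + (3 * j + k)) / 3 % 3 = j := by omega
    have e3 : (9 * i + (3 * j + k)) % 3 = k := by omega
    simp only [φ, e1, e2, e3]
  have hm : ∀ x y, φ (mul27 α β γ x y) = φ x * φ y := by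
    intro x y
    rw [mul27, hφ _ _ _ (Nat.mod_lt _ (by norm_num)) (Nat.mod_lt _ (by norm_num)), hmod]
    simp only [φ]
    generalize x / 9 = i
    generalize x / 3 % 3 = j
    generalize x % 3 = k
    generalize y / 9 = i'
    generalize y / 3 % 3 = j'
    generalize y % 3 = k'
    symm
    calc a ^ i * b ^ j * c ^ k * (a ^ i' * b ^ j' * c ^ k')
        = a ^ i * b ^ j * (c ^ k * (a ^ i' * b ^ j')) * c ^ k' := by simp only [mul_assoc]
      _ = a ^ i * (b ^ j * a ^ i') * b ^ j' * (c ^ k * c ^ k') := by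
        rw [hcc]; simp only [mul_assoc]
      _ = a ^ i * a ^ i' * b ^ j * (c ^ (γ * j * i') * b ^ j') * (c ^ k * c ^ k') := by
        rw [hba]; simp only [mul_assoc]
      _ = a ^ (i + i') * b ^ (j + j') * (c ^ (γ * j * i') * (c ^ k * c ^ k')) := by
        rw [hcc, pow_add, pow_add]; simp only [mul_assoc]
      _ = a ^ ((i + i') % 3) * (c ^ (α * ((i + i') / 3)) * b ^ ((j + j') % 3))
            * c ^ (β * ((j + j') / 3)) * (c ^ (γ * j * i') * (c ^ k * c ^ k')) := by
        rw [hamod (i + i'), hbmod (j + j')]; simp only [mul_assoc]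
      _ = a ^ ((i + i') % 3) * b ^ ((j + j') % 3) * (c ^ (α * ((i + i') / 3))
            * (c ^ (β * ((j + j') / 3)) * (c ^ (γ * j * i') * (c ^ k * c ^ k')))) := by
        rw [hcc]; simp only [mul_assoc]
      _ = _ := by
        simp only [← pow_add]
        congr 2
        ring
  have hchk := check27_all α hα β hβ γ hγ
  simp only [check27, Bool.and_eq_true, List.all_eq_true, List.mem_range, Nat.beq_eq] at hchk
  obtain ⟨h0, h1, h2, h3, h4⟩ := hchk
  refine colouring_transport 27 hG φ (mul27 α β γ) (inv27 α β γ) (sig27 α β γ) ?_ hm ?_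
    (onto_spec h1) (onto_spec h2) (onto_spec h3) (onto_spec h4)
  · intro g
    obtain ⟨i, hi, j, hj, k, hk, rfl⟩ := hgen g
    exact ⟨9 * i + (3 * j + k), by omega, hφ i j k hj hk⟩
  · intro x hx
    rw [eq_inv_iff_mul_eq_one]
    have := hm x (inv27 α β γ x)
    rw [h0 x hx] at this
    have h00 : φ 0 = 1 := by simp [φ]
    rw [h00] at this
    exact mul_eq_one_comm.1 this.symm

theorem gens_of_card_nine {Q : Type*} [Group Q] [Finite Q] (hQ : Nat.card Q = 9) (hnc : ¬ IsCyclic Q) :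
    (∀ x y : Q, x * y = y * x) ∧ (∀ x : Q, x ^ 3 = 1) ∧
    ∃ a b : Q, ∀ g, ∃ i < 3, ∃ j < 3, g = a ^ i * b ^ j := by
  have : Fact (Nat.Prime 3) := ⟨by norm_num⟩
  have hcomm : ∀ x y : Q, x * y = y * x :=
    (IsPGroup.isMulCommutative_of_card_eq_prime_sq (p := 3) (by rw [hQ]; norm_num)).is_comm.comm
  have hexp : ∀ x : Q, x ^ 3 = 1 := by
    intro x
    have h1 : orderOf x ∣ 3 ^ 2 := by
      have := orderOf_dvd_natCard x
      rw [hQ] at this; exact this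
    obtain ⟨k, hk, hx⟩ := (Nat.dvd_prime_pow Nat.prime_three).1 h1
    rw [← orderOf_dvd_iff_pow_eq_one, hx]
    interval_cases k
    · norm_num
    · norm_num
    · exact absurd (isCyclic_of_orderOf_eq_card x (by rw [hx, hQ]; norm_num)) hnc
  refine ⟨hcomm, hexp, ?_⟩
  have hmod : ∀ (x : Q) (n : ℕ), x ^ n = x ^ (n % 3) := by
    intro x n
    conv_lhs => rw [← Nat.mod_add_div n 3, pow_add, pow_mul, hexp, one_pow, mul_one]
  have hnt : Nontrivial Q := Finite.one_lt_card_iff_nontrivial.1 (by omega)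
  obtain ⟨a, ha⟩ := exists_ne (1 : Q)
  have hoa : orderOf a = 3 := orderOf_eq_prime (hexp a) ha
  obtain ⟨b, hb⟩ : ∃ b, b ∉ Subgroup.zpowers a := by
    by_contra! h
    exact hnc ⟨a, h⟩
  have hN : (Subgroup.zpowers a).Normal := ⟨fun n hn g => by
    rw [hcomm g n, mul_assoc, mul_inv_cancel, mul_one]; exact hn⟩
  have hcq : Nat.card (Q ⧸ Subgroup.zpowers a) = 3 := by
    have := Subgroup.card_eq_card_quotient_mul_card_subgroup (Subgroup.zpowers a)
    rw [hQ, Nat.card_zpowers, hoa] at this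
    omega
  refine ⟨a, b, fun g => ?_⟩
  have hb' : (b : Q ⧸ Subgroup.zpowers a) ≠ 1 := by
    rw [Ne, QuotientGroup.eq_one_iff]; exact hb
  obtain ⟨j, hj⟩ := mem_powers_of_prime_card (g' := (g : Q ⧸ Subgroup.zpowers a)) hcq hb'
  have hj' : ((b ^ j : Q) : Q ⧸ Subgroup.zpowers a) = g := hj
  rw [QuotientGroup.eq] at hj'
  obtain ⟨i, hi⟩ := (mem_powers_iff_mem_zpowers).2 hj'
  refine ⟨i % 3, Nat.mod_lt _ (by norm_num), j % 3, Nat.mod_lt _ (by norm_num), ?_⟩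
  rw [← hmod, ← hmod, hcomm]
  have hi' : a ^ i = (b ^ j)⁻¹ * g := hi
  rw [hi']; group

theorem exists_central {G : Type*} [Group G] [Finite G] (hG : Nat.card G = 27)
    (hnc : ¬ IsCyclic G) :
    ∃ c : G, orderOf c = 3 ∧ (∀ g, c * g = g * c) ∧
      ∀ h : (Subgroup.zpowers c).Normal, ¬ IsCyclic (G ⧸ Subgroup.zpowers c) := by
  have : Fact (Nat.Prime 3) := ⟨by norm_num⟩
  have hp : IsPGroup 3 G := IsPGroup.of_card (n := 3) (by rw [hG]; norm_num)
  have hnt : Nontrivial G := Finite.one_lt_card_iff_nontrivial.1 (by omega)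
  have hz := hp.center_nontrivial
  obtain ⟨c, hcc, hc3⟩ : ∃ c : G, (∀ g, c * g = g * c) ∧ orderOf c = 3 := by
    have hpz := hp.to_subgroup (Subgroup.center G)
    obtain ⟨n, hn, hcard⟩ := hpz.nontrivial_iff_card.1 hz
    obtain ⟨c, hc⟩ := exists_prime_orderOf_dvd_card' (G := Subgroup.center G) 3
      (by rw [hcard]; exact dvd_pow_self 3 (by omega))
    refine ⟨c, fun g => (Subgroup.mem_center_iff.1 c.2 g).symm, ?_⟩
    rw [Subgroup.orderOf_coe]; exact hc
  by_cases hcomm : ∀ x y : G, x * y = y * x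
  · by_cases hexp : ∀ x : G, x ^ 3 = 1
    · refine ⟨c, hc3, hcc, fun hN hcyc => ?_⟩
      have hcard : Nat.card (G ⧸ Subgroup.zpowers c) = 9 := by
        have := Subgroup.card_eq_card_quotient_mul_card_subgroup (Subgroup.zpowers c)
        rw [hG, Nat.card_zpowers, hc3] at this
        omega
      obtain ⟨q, hq⟩ := hcyc
      have h9 : orderOf q = 9 := by
        rw [orderOf_eq_card_of_forall_mem_zpowers hq, hcard]
      obtain ⟨b, rfl⟩ := QuotientGroup.mk_surjective q
      have h3 : orderOf (b : G ⧸ Subgroup.zpowers c) ∣ 3 := by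
        rw [orderOf_dvd_iff_pow_eq_one, ← QuotientGroup.mk_pow, hexp]; rfl
      rw [h9] at h3
      norm_num at h3
    · push Not at hexp
      obtain ⟨a, ha⟩ := hexp
      have h9 : a ^ 9 = 1 := by
        have h1 : orderOf a ∣ 3 ^ 3 := by
          have := orderOf_dvd_natCard a
          rw [hG] at this; exact this
        obtain ⟨k, hk, hx⟩ := (Nat.dvd_prime_pow Nat.prime_three).1 h1
        rw [← orderOf_dvd_iff_pow_eq_one, hx]
        interval_cases k
        · norm_num
        · norm_num
        · norm_num
        · exact absurd (isCyclic_of_orderOf_eq_card a (by rw [hx, hG]; norm_num)) hnc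
      have h33 : (a ^ 3) ^ 3 = 1 := by rw [← pow_mul]; exact h9
      refine ⟨a ^ 3, orderOf_eq_prime h33 ha, fun g => hcomm _ _, fun hN hcyc => hnc ?_⟩
      obtain ⟨q, hq⟩ := hcyc
      obtain ⟨b, rfl⟩ := QuotientGroup.mk_surjective q
      have hdec : ∀ g : G, ∃ n m : ℤ, g = b ^ n * (a ^ 3) ^ m := by
        intro g
        obtain ⟨n, hn⟩ := hq g
        have hn' : ((b ^ n : G) : G ⧸ Subgroup.zpowers (a ^ 3)) = g := hn
        rw [QuotientGroup.eq] at hn'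
        obtain ⟨m, hm⟩ := hn'
        have hm' : (a ^ 3) ^ m = (b ^ n)⁻¹ * g := hm
        exact ⟨n, m, by rw [hm']; group⟩
      obtain ⟨n, m, hnm⟩ := hdec a
      have ha3 : a ^ 3 = b ^ (n * 3) := by
        calc a ^ 3 = (b ^ n * (a ^ 3) ^ m) ^ 3 := by rw [← hnm]
          _ = (b ^ n) ^ 3 * ((a ^ 3) ^ m) ^ 3 := Commute.mul_pow (hcomm _ _) 3
          _ = b ^ (n * 3) := by
            have : ((a ^ 3) ^ m) ^ 3 = 1 := by
              rw [← zpow_natCast ((a ^ 3) ^ m), ← zpow_mul, mul_comm, zpow_mul, zpow_natCast, h33,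
                one_zpow]
            rw [this, mul_one, zpow_mul]; norm_cast
      refine ⟨b, fun g => ?_⟩
      obtain ⟨u, v, rfl⟩ := hdec g
      rw [ha3]
      exact Subgroup.mul_mem _ (Subgroup.zpow_mem_zpowers b u)
        (Subgroup.zpow_mem _ (Subgroup.zpow_mem_zpowers b _) v)
  · refine ⟨c, hc3, hcc, fun hN hcyc => hcomm ?_⟩
    refine fun x y => commutative_of_cyclic_center_quotient
      (QuotientGroup.mk' (Subgroup.zpowers c)) ?_ x y
    rw [QuotientGroup.ker_mk', Subgroup.zpowers_le]
    exact Subgroup.mem_center_iff.2 fun g => (hcc g).symm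

theorem colour_order27 {G : Type*} [Group G] [Fintype G] (hG : Fintype.card G = 27)
    (hnc : ¬ IsCyclic G) : ∃ σ : G → G, IsColouringBijection σ := by
  have hG' : Nat.card G = 27 := by rw [Nat.card_eq_fintype_card, hG]
  obtain ⟨c, hc3, hcc, hq⟩ := exists_central hG' hnc
  have hN : (Subgroup.zpowers c).Normal := by
    refine ⟨fun n hn g => ?_⟩
    obtain ⟨k, rfl⟩ := hn
    have : c ^ k * g = g * c ^ k := Commute.zpow_left (hcc g) k
    change g * c ^ k * g⁻¹ ∈ _
    rw [← this, mul_assoc, mul_inv_cancel, mul_one]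
    exact Subgroup.zpow_mem_zpowers c k
  have hcard : Nat.card (G ⧸ Subgroup.zpowers c) = 9 := by
    have := Subgroup.card_eq_card_quotient_mul_card_subgroup (Subgroup.zpowers c)
    rw [hG', Nat.card_zpowers, hc3] at this
    omega
  obtain ⟨hcomm, hexp, a, b, hgen⟩ := gens_of_card_nine hcard (hq hN)
  obtain ⟨a, rfl⟩ := QuotientGroup.mk_surjective a
  obtain ⟨b, rfl⟩ := QuotientGroup.mk_surjective b
  have hc1 : c ^ 3 = 1 := by rw [← hc3]; exact pow_orderOf_eq_one c
  have hmem : ∀ g ∈ Subgroup.zpowers c, ∃ k < 3, g = c ^ k := by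
    intro g hg
    obtain ⟨k, hk⟩ := (mem_powers_iff_mem_zpowers).2 hg
    refine ⟨k % 3, Nat.mod_lt _ (by norm_num), ?_⟩
    have hk' : c ^ k = g := hk
    rw [← hk']
    conv_lhs => rw [← Nat.mod_add_div k 3, pow_add, pow_mul, hc1, one_pow, mul_one]
  have hcube : ∀ g : G, ∃ k < 3, g ^ 3 = c ^ k := by
    intro g
    apply hmem
    rw [← QuotientGroup.eq_one_iff, QuotientGroup.mk_pow, hexp]
  obtain ⟨α, hα, ha⟩ := hcube a
  obtain ⟨β, hβ, hb⟩ := hcube b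
  have hquot : ∀ x y : G, (x : G ⧸ Subgroup.zpowers c) = y → ∃ k < 3, y = x * c ^ k := by
    intro x y hxy
    obtain ⟨k, hk, h⟩ := hmem _ (QuotientGroup.eq.1 hxy)
    exact ⟨k, hk, by rw [← h]; group⟩
  obtain ⟨γ, hγ, hab⟩ := hquot (a * b) (b * a) (by
    rw [QuotientGroup.mk_mul, QuotientGroup.mk_mul]; exact hcomm _ _)
  refine colouring27 hG a b c α β γ hα hβ hγ hcc hc1 ha hb hab ?_
  intro g
  obtain ⟨i, hi, j, hj, h⟩ := hgen g
  obtain ⟨k, hk, h⟩ := hquot (a ^ i * b ^ j) g (by rw [h]; rfl)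
  exact ⟨i, hi, j, hj, k, hk, h⟩

theorem colour_order9 {G : Type*} [Group G] [Fintype G] (hG : Fintype.card G = 9)
    (hnc : ¬ IsCyclic G) : ∃ σ : G → G, IsColouringBijection σ := by
  have hG' : Nat.card G = 9 := by rw [Nat.card_eq_fintype_card, hG]
  obtain ⟨hcomm, hexp, a, b, hgen⟩ := gens_of_card_nine hG' hnc
  have hmod : ∀ (x : G) (n : ℕ), x ^ (n % 3) = x ^ n := by
    intro x n
    conv_rhs => rw [← Nat.mod_add_div n 3, pow_add, pow_mul, hexp, one_pow, mul_one]
  let φ : ℕ → G := fun x => a ^ (x / 3) * b ^ (x % 3)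
  have hφ : ∀ i j, j < 3 → φ (3 * i + j) = a ^ i * b ^ j := by
    intro i j hj
    have e1 : (3 * i + j) / 3 = i := by omega
    have e2 : (3 * i + j) % 3 = j := by omega
    simp only [φ, e1, e2]
  have hm : ∀ x y, φ (3 * ((x / 3 + y / 3) % 3) + (x % 3 + y % 3) % 3) = φ x * φ y := by
    intro x y
    rw [hφ _ _ (Nat.mod_lt _ (by norm_num)), hmod, hmod, pow_add, pow_add]
    simp only [φ, mul_assoc]
    congr 1
    rw [← mul_assoc, hcomm (a ^ (y / 3)), mul_assoc]
  refine colouring_transport 9 hG φ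
    (fun x y => 3 * ((x / 3 + y / 3) % 3) + (x % 3 + y % 3) % 3)
    (fun x => 3 * ((3 - x / 3) % 3) + (3 - x % 3) % 3)
    (fun x => 3 * ((3 - x % 3) % 3) + x / 3) ?_ hm ?_ (by decide) (by decide) (by decide)
    (by decide)
  · intro g
    obtain ⟨i, hi, j, hj, rfl⟩ := hgen g
    exact ⟨3 * i + j, by omega, hφ i j hj⟩
  · intro x hx
    rw [eq_inv_iff_mul_eq_one, ← hm]
    have h00 : φ 0 = 1 := by simp [φ]
    rw [← h00]
    congr 1
    omega

/-- Every noncyclic group of order at most 27 whose order is a power of 3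
admits a colouring bijection. -/
theorem small_3groups_colourable
    (G : Type*) [Group G] [Fintype G]
    (h3 : ∃ n : ℕ, Fintype.card G = 3 ^ n)
    (hle : Fintype.card G ≤ 27)
    (hnc : ¬ IsCyclic G) :
    ∃ σ : G → G, IsColouringBijection σ := by
  obtain ⟨n, hn⟩ := h3
  have hn3 : n ≤ 3 := by
    by_contra! h
    have : 3 ^ 4 ≤ 3 ^ n := Nat.pow_le_pow_right (by norm_num) h
    omega
  interval_cases n
  · exact absurd (@isCyclic_of_subsingleton G _
      ((Fintype.card_le_one_iff_subsingleton).1 (by omega))) hnc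
  · have : Fact (Nat.Prime 3) := ⟨by norm_num⟩
    exact absurd (isCyclic_of_prime_card (p := 3)
      (by rw [Nat.card_eq_fintype_card, hn]; norm_num)) hnc
  · exact colour_order9 (by rw [hn]; norm_num) hnc
  · exact colour_order27 (by rw [hn]; norm_num) hnc
end

section
/- Let G be a finite 3-group of order greater than 27 such that every maximal subgroup of G is noncyclic. Then G contains a normal subgroup H isomorphic to C₃ × C₃ such that the quotient G/H is not cyclic. -/
/-- `G/H` is not cyclic (stated for a normal subgroup given by an explicit proof
of normality, so that the quotient carries its group structure). -/
def QuotientNotCyclic {G : Type*} [Group G] (H : Subgroup G) (hn : H.Normal) : Prop :=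
  haveI := hn
  ¬ IsCyclic (G ⧸ H)

open Subgroup

/-- A subgroup generated by two commuting elements of order 3 is `C₃ × C₃`. -/
lemma closure_pair_equiv {G : Type*} [Group G] (z w : G) (hzw : Commute z w)
    (hz : z ^ 3 = 1) (hw : w ^ 3 = 1) (hz1 : z ≠ 1) (hwz : w ∉ zpowers z) :
    Nonempty (closure ({z, w} : Set G) ≃* Multiplicative (ZMod 3 × ZMod 3)) := by
  have key : ∀ (t : G), t ^ 3 = 1 → ∀ a b : ZMod 3,
      t ^ (a + b).val = t ^ a.val * t ^ b.val := by
    intro t ht a b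
    rw [ZMod.val_add, ← pow_add, ← pow_mod_orderOf, ← pow_mod_orderOf t (a.val + b.val),
      Nat.mod_mod_of_dvd _ (orderOf_dvd_of_pow_eq_one ht)]
  let φ : Multiplicative (ZMod 3 × ZMod 3) →* G :=
    { toFun := fun x => z ^ (x.toAdd.1).val * w ^ (x.toAdd.2).val
      map_one' := by simp
      map_mul' := by
        intro x y
        simp only [toAdd_mul, Prod.fst_add, Prod.snd_add]
        rw [key z hz, key w hw]
        have := (hzw.pow_pow (y.toAdd.1).val (x.toAdd.2).val).eq
        simp only [mul_assoc]
        rw [← mul_assoc (z ^ (y.toAdd.1).val), this]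
        simp only [mul_assoc] }
  have hφ : ∀ x, φ x = z ^ (x.toAdd.1).val * w ^ (x.toAdd.2).val := fun _ => rfl
  have hinj : Function.Injective φ := by
    rw [injective_iff_map_eq_one]
    intro x hx
    rw [hφ] at hx
    obtain ⟨i, j⟩ := x
    have hj : j = 0 := by
      have hm : w ^ j.val ∈ zpowers z := by
        have : w ^ j.val = (z ^ i.val)⁻¹ := (inv_eq_of_mul_eq_one_right hx).symm
        rw [this]
        exact inv_mem (pow_mem (mem_zpowers z) _)
      by_contra hj
      apply hwz
      have : j.val = 1 ∨ j.val = 2 := by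
        have := j.val_lt
        have : j.val ≠ 0 := by simpa using hj
        omega
      rcases this with h | h
      · simpa [h] using hm
      · rw [h] at hm
        have h2 := pow_mem hm 2
        have : (w ^ 2) ^ 2 = w := by
          rw [← pow_mul, pow_succ w 3, hw, one_mul]
        rwa [this] at h2
    subst hj
    have hi : i = 0 := by
      by_contra hi
      apply hz1
      have : i.val = 1 ∨ i.val = 2 := by
        have := i.val_lt
        have : i.val ≠ 0 := by simpa using hi
        omega
      have hx' : z ^ i.val = 1 := by
        have h0 : z ^ i.val * w ^ (0 : ZMod 3).val = 1 := hx
        simpa using h0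
      rcases this with h | h
      · simpa [h] using hx'
      · rw [h] at hx'
        rwa [pow_succ, hx', one_mul] at hz
    subst hi
    rfl
  have hrange : φ.range = closure ({z, w} : Set G) := by
    apply le_antisymm
    · rintro _ ⟨x, rfl⟩
      rw [hφ]
      exact mul_mem (pow_mem (subset_closure (by simp)) _) (pow_mem (subset_closure (by simp)) _)
    · rw [closure_le]
      rintro t (rfl | rfl)
      · exact ⟨Multiplicative.ofAdd (1, 0), by simp [hφ, ZMod.val_one]⟩
      · exact ⟨Multiplicative.ofAdd (0, 1), by simp [hφ, ZMod.val_one]⟩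
  rw [← hrange]
  exact ⟨(MonoidHom.ofInjective hinj).symm⟩

/-- A nontrivial normal subgroup of a finite 3-group has a central element of order 3. -/
lemma exists_central_s17 {G : Type*} [Group G] [Finite G] (hG : IsPGroup 3 G) (N : Subgroup G)
    [N.Normal] (hN : N ≠ ⊥) : ∃ z ∈ N, z ∈ center G ∧ z ^ 3 = 1 ∧ z ≠ 1 := by
  have : Fact (Nat.Prime 3) := ⟨Nat.prime_three⟩
  have hd : 3 ∣ Nat.card N := by
    rcases (hG.to_subgroup N).card_eq_or_dvd with h | h
    · exact absurd ((Subgroup.card_eq_one).1 h) hN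
    · exact h
  obtain ⟨b, hb, hb1⟩ := (hG.of_equiv ConjAct.toConjAct
    ).exists_fixed_point_of_prime_dvd_card_of_fixed_point N hd (a := 1)
      (by intro g; exact smul_one g)
  have hbc : (b : G) ∈ center G := by
    rw [mem_center_iff]
    intro g
    have := congrArg Subtype.val (hb (ConjAct.toConjAct g))
    rw [ConjAct.Subgroup.val_conj_smul, ConjAct.toConjAct_smul] at this
    exact mul_inv_eq_iff_eq_mul.1 this
  have hb1' : (b : G) ≠ 1 := fun h => hb1 (Subtype.ext h.symm)
  obtain ⟨k, hk⟩ := (IsPGroup.iff_orderOf.1 hG) (b : G)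
  have hk0 : k ≠ 0 := by
    rintro rfl
    exact hb1' (orderOf_eq_one_iff.1 (by simpa using hk))
  obtain ⟨m, rfl⟩ := Nat.exists_eq_succ_of_ne_zero hk0
  refine ⟨(b : G) ^ 3 ^ m, pow_mem b.2 _, pow_mem hbc _, ?_, ?_⟩
  · rw [← pow_mul, ← pow_succ, ← hk, pow_orderOf_eq_one]
  · intro h
    have := orderOf_dvd_of_pow_eq_one h
    rw [hk] at this
    have := (Nat.pow_dvd_pow_iff_le_right (by norm_num : 1 < 3)).1 this
    omega

lemma exists_central_mod {G : Type*} [Group G] [Finite G] (hG : IsPGroup 3 G) (A : Subgroup G)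
    [A.Normal] (hA : A ≠ ⊤) : ∃ y, y ∉ A ∧ y ^ 3 ∈ A ∧ ∀ g, g * y * g⁻¹ * y⁻¹ ∈ A := by
  have hne : (⊤ : Subgroup (G ⧸ A)) ≠ ⊥ := by
    intro h
    apply hA
    rw [eq_top_iff]
    intro g _
    have : (g : G ⧸ A) ∈ (⊥ : Subgroup (G ⧸ A)) := h ▸ mem_top _
    exact (QuotientGroup.eq_one_iff g).1 (mem_bot.1 this)
  obtain ⟨z, -, hzc, hz3, hz1⟩ := exists_central_s17 (hG.to_quotient A) ⊤ hne
  obtain ⟨y, rfl⟩ := QuotientGroup.mk_surjective z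
  refine ⟨y, ?_, ?_, ?_⟩
  · exact fun h => hz1 ((QuotientGroup.eq_one_iff y).2 h)
  · rw [← QuotientGroup.eq_one_iff]
    exact hz3
  · intro g
    rw [← QuotientGroup.eq_one_iff]
    have := mem_center_iff.1 hzc (g : G ⧸ A)
    change (g : G ⧸ A) * (y : G ⧸ A) * (g : G ⧸ A)⁻¹ * (y : G ⧸ A)⁻¹ = 1
    rw [this]
    group

lemma arith_aux (k : ℕ) (hk : k ≠ 0) (r : ℤ) (h : ((3 ^ k : ℕ) : ℤ) ∣ r ^ 3 - 1) :
    (3 : ℤ) ∣ r - 1 ∧ ((3 ^ k : ℕ) : ℤ) ∣ 3 * (r - 1) := by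
  have h3 : (3 : ℤ) ∣ r - 1 := by
    have h1 : (3 : ℤ) ∣ r ^ 3 - 1 := by
      refine dvd_trans ?_ h
      push_cast
      exact dvd_pow_self _ hk
    have h2 : (3 : ℤ) ∣ (r - 1) ^ 3 := by
      have : (r - 1) ^ 3 = (r ^ 3 - 1) - 3 * (r ^ 2 - r) := by ring
      rw [this]
      exact dvd_sub h1 (Dvd.intro _ rfl)
    exact Int.prime_three.dvd_of_dvd_pow h2
  refine ⟨h3, ?_⟩
  obtain ⟨s, hs⟩ := h3
  have hr : r = 1 + 3 * s := by linarith
  have e : r ^ 3 - 1 = (3 * (r - 1)) * (1 + 3 * (s + s ^ 2)) := by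
    rw [hr]; ring
  rw [e] at h
  refine IsCoprime.dvd_of_dvd_mul_right ?_ h
  push_cast
  apply IsCoprime.pow_left
  exact ⟨-(s + s ^ 2), 1, by ring⟩

lemma cube_mul {G : Type*} [Group G] (a : G) (k : ℕ) (hk : k ≠ 0) (ha : orderOf a = 3 ^ k)
    [hn : (zpowers a).Normal] (y : G) (hy : y ^ 3 ∈ zpowers a) (b : G) (hb : b ∈ zpowers a) :
    (y * b) ^ 3 = y ^ 3 * b ^ 3 := by
  obtain ⟨r, hr⟩ := mem_zpowers_iff.1 (hn.conj_mem a (mem_zpowers a) y)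
  have conj : ∀ m : ℤ, y * a ^ m * y⁻¹ = a ^ (r * m) := by
    intro m
    rw [← conj_zpow, ← hr, zpow_mul]
  have h3 : a ^ (r ^ 3) = a := by
    obtain ⟨m, hm⟩ := mem_zpowers_iff.1 hy
    have e1 : y ^ 3 * a * (y ^ 3)⁻¹ = a := by
      rw [← hm]; group
    have e2 : y ^ 3 * a * (y ^ 3)⁻¹ = y * (y * (y * a ^ (1 : ℤ) * y⁻¹) * y⁻¹) * y⁻¹ := by
      simp only [pow_succ, pow_zero, one_mul, zpow_one, mul_inv_rev, mul_assoc]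
    rw [conj, conj, conj] at e2
    have e3 : r ^ 3 = r * (r * (r * 1)) := by ring
    rw [e3, ← e2, e1]
  have hdvd : ((3 ^ k : ℕ) : ℤ) ∣ r ^ 3 - 1 := by
    rw [← ha, orderOf_dvd_iff_zpow_eq_one, zpow_sub, h3]
    simp
  obtain ⟨h1, h2⟩ := arith_aux k hk r hdvd
  obtain ⟨i, rfl⟩ := mem_zpowers_iff.1 hb
  -- y a^i = a^{ri} y
  have sw : ∀ m : ℤ, y * a ^ m = a ^ (r * m) * y := fun m => by
    rw [← conj]; group
  have e : (y * a ^ i) ^ 3 = a ^ (r * i + r * (r * i) + r * (r * (r * i))) * y ^ 3 := by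
    have : (y * a ^ i) ^ 3 = (y * a ^ i) * ((y * a ^ i) * (y * a ^ i)) := by
      rw [pow_succ', pow_two]
    rw [this, sw]
    have : a ^ (r * i) * y * (a ^ (r * i) * y * (a ^ (r * i) * y))
      = a ^ (r * i) * (y * a ^ (r * i)) * (y * a ^ (r * i)) * y := by group
    rw [this, sw]
    have : a ^ (r * i) * (a ^ (r * (r * i)) * y) * (a ^ (r * (r * i)) * y) * y
      = a ^ (r * i) * a ^ (r * (r * i)) * (y * a ^ (r * (r * i))) * y * y := by group
    rw [this, sw, zpow_add, zpow_add]
    simp only [pow_succ, pow_zero, one_mul, mul_assoc]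
  rw [e]
  have e2 : y ^ 3 * (a ^ i) ^ 3 = (a ^ i) ^ 3 * y ^ 3 := by
    obtain ⟨m, hm⟩ := mem_zpowers_iff.1 hy
    rw [← hm, ← zpow_natCast, ← zpow_mul, ← zpow_add, ← zpow_add, add_comm]
  rw [e2]
  congr 1
  rw [← zpow_natCast, ← zpow_mul, ← mul_inv_eq_one, ← zpow_neg, ← zpow_add,
    ← orderOf_dvd_iff_zpow_eq_one, ha]
  obtain ⟨s, hs⟩ := h1
  have hr' : r = 1 + 3 * s := by linarith
  refine h2.trans ⟨i * (2 + 4 * s + 3 * s ^ 2), ?_⟩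
  rw [hr']
  push_cast
  ring

/-- A noncyclic finite 3-group has a normal `C₃ × C₃`, given by explicit generators. -/
lemma exists_gens {G : Type*} [Group G] [Finite G] (hG : IsPGroup 3 G) (hc : ¬ IsCyclic G) :
    ∃ z w : G, z ∈ center G ∧ z ^ 3 = 1 ∧ z ≠ 1 ∧ w ^ 3 = 1 ∧ w ∉ zpowers z ∧
      ∀ g, g * w * g⁻¹ * w⁻¹ ∈ zpowers z := by
  have : Fact (Nat.Prime 3) := ⟨Nat.prime_three⟩
  obtain ⟨A, ⟨hAn, hAc⟩, hmax⟩ : ∃ A : Subgroup G, (A.Normal ∧ IsCyclic A) ∧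
      ∀ B : Subgroup G, B.Normal ∧ IsCyclic B → A ≤ B → B ≤ A := by
    obtain ⟨A, hA⟩ := (Set.toFinite {A : Subgroup G | A.Normal ∧ IsCyclic A}).exists_maximal
      ⟨⊥, inferInstance, inferInstance⟩
    exact ⟨A, hA.1, fun B hB h => hA.2 hB h⟩
  have hAtop : A ≠ ⊤ := by
    rintro rfl
    exact hc (Subgroup.topEquiv.isCyclic.1 hAc)
  obtain ⟨a, rfl⟩ : ∃ a : G, zpowers a = A := (Subgroup.isCyclic_iff_exists_zpowers_eq_top A).1 hAc
  obtain ⟨y, hyA, hy3, hyg⟩ := exists_central_mod hG _ hAtop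
  -- the subgroup generated by a and y is not cyclic
  have hnc : ¬ zpowers a ≤ zpowers y := by
    intro hle
    apply hyA
    have hnorm : (zpowers y).Normal := by
      refine ⟨fun n hn g => ?_⟩
      obtain ⟨i, rfl⟩ := mem_zpowers_iff.1 hn
      rw [← conj_zpow]
      apply zpow_mem
      have := mul_mem (hle (hyg g)) (mem_zpowers y)
      simpa using this
    exact hmax _ ⟨hnorm, inferInstance⟩ hle (mem_zpowers y)
  obtain ⟨k, hk⟩ := (IsPGroup.iff_orderOf.1 hG) a
  have hk0 : k ≠ 0 := by
    rintro rfl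
    apply hnc
    have ha1 : a = 1 := orderOf_eq_one_iff.1 (by simpa using hk)
    rw [ha1]
    simp
  have hAbot : zpowers a ≠ ⊥ := by
    intro h
    apply hnc
    rw [h]
    exact bot_le
  obtain ⟨z, hzA, hzc, hz3, hz1⟩ := exists_central_s17 hG (zpowers a) hAbot
  -- adjust y
  obtain ⟨w, hwA, hw3, hwg⟩ : ∃ w, w ∉ zpowers a ∧ w ^ 3 = 1 ∧
      ∀ g, g * w * g⁻¹ * w⁻¹ ∈ zpowers a := by
    obtain ⟨m, hm⟩ := mem_zpowers_iff.1 hy3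
    have h3m : (3 : ℤ) ∣ m := by
      by_contra h3
      apply hnc
      rw [zpowers_le]
      have hcop : IsCoprime m ((3 ^ k : ℕ) : ℤ) := by
        push_cast
        apply IsCoprime.pow_right
        exact ((Int.prime_three.coprime_iff_not_dvd).2 h3).symm
      obtain ⟨u, v, huv⟩ := hcop
      have : a = (y ^ 3) ^ u := by
        rw [← hm, ← zpow_mul]
        have h1 : a ^ (v * ((3 ^ k : ℕ) : ℤ)) = 1 := by
          rw [← orderOf_dvd_iff_zpow_eq_one, hk]
          exact Dvd.intro_left _ rfl
        calc a = a ^ (u * m + v * ((3 ^ k : ℕ) : ℤ)) := by rw [huv, zpow_one]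
          _ = a ^ (m * u) := by rw [zpow_add, h1, mul_one, mul_comm]
      rw [this]
      exact zpow_mem (pow_mem (mem_zpowers y) _) _
    obtain ⟨s, rfl⟩ := h3m
    have hb : a ^ (-s) ∈ zpowers a := zpow_mem (mem_zpowers a) _
    refine ⟨y * a ^ (-s), ?_, ?_, ?_⟩
    · intro h
      exact hyA ((Subgroup.mul_mem_cancel_right _ hb).1 h)
    · rw [cube_mul a k hk0 hk y hy3 _ hb, ← hm, ← zpow_natCast, ← zpow_mul, ← zpow_add]
      have : 3 * s + -s * ((3 : ℕ) : ℤ) = 0 := by push_cast; ring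
      rw [this, zpow_zero]
    · intro g
      have e : g * (y * a ^ (-s)) * g⁻¹ * (y * a ^ (-s))⁻¹ =
        (g * y * g⁻¹ * y⁻¹) * (y * ((g * a ^ (-s) * g⁻¹) * (a ^ (-s))⁻¹) * y⁻¹) := by
        simp only [mul_inv_rev, mul_assoc, inv_mul_cancel_left]
      rw [e]
      exact mul_mem (hyg g) (hAn.conj_mem _ (mul_mem (hAn.conj_mem _ hb g) (inv_mem hb)) y)
  have hzle : zpowers z ≤ zpowers a := by rwa [zpowers_le]
  -- elements of A with trivial cube lie in the subgroup generated by z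
  have hOmega : ∀ c ∈ zpowers a, c ^ 3 = 1 → c ∈ zpowers z := by
    intro c hcA hc3
    obtain ⟨k', rfl⟩ := Nat.exists_eq_add_one_of_ne_zero hk0
    have hdiv : ∀ m : ℤ, (a ^ m) ^ 3 = 1 → ∃ m', m = 3 ^ k' * m' := by
      intro m hm
      rw [← zpow_natCast, ← zpow_mul, ← orderOf_dvd_iff_zpow_eq_one, hk] at hm
      push_cast at hm
      rw [pow_succ] at hm
      exact (mul_dvd_mul_iff_right (by norm_num)).1 hm
    obtain ⟨m, rfl⟩ := mem_zpowers_iff.1 hcA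
    obtain ⟨j, rfl⟩ := mem_zpowers_iff.1 hzA
    obtain ⟨m', rfl⟩ := hdiv m hc3
    obtain ⟨j', rfl⟩ := hdiv j hz3
    have h3j : ¬ (3 : ℤ) ∣ j' := by
      rintro ⟨t, rfl⟩
      apply hz1
      rw [← orderOf_dvd_iff_zpow_eq_one, hk]
      exact ⟨t, by push_cast; ring⟩
    obtain ⟨u, v, huv⟩ := (Int.prime_three.coprime_iff_not_dvd).2 h3j
    refine mem_zpowers_iff.2 ⟨v * m', ?_⟩
    rw [← zpow_mul, ← mul_inv_eq_one, ← zpow_neg, ← zpow_add, ← orderOf_dvd_iff_zpow_eq_one, hk]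
    refine ⟨-(u * m'), ?_⟩
    push_cast
    have : v * j' = 1 - u * 3 := by linarith
    linear_combination (3 ^ k' * m') * this
  refine ⟨z, w, hzc, hz3, hz1, hw3, fun h => hwA (hzle h), ?_⟩
  intro g
  apply hOmega _ (hwg g)
  -- g w g⁻¹ = w * b, with b in A
  have hb : w⁻¹ * (g * w * g⁻¹ * w⁻¹) * w ∈ zpowers a := by
    simpa using hAn.conj_mem _ (hwg g) w⁻¹
  have h := cube_mul a k hk0 hk w (by rw [hw3]; exact one_mem _) _ hb
  have e1 : w * (w⁻¹ * (g * w * g⁻¹ * w⁻¹) * w) = g * w * g⁻¹ := by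
    simp only [mul_assoc, mul_inv_cancel_left, inv_mul_cancel, mul_one]
  rw [e1, conj_pow, hw3, one_mul, mul_one, mul_inv_cancel] at h
  have e2 : g * w * g⁻¹ * w⁻¹ = w * (w⁻¹ * (g * w * g⁻¹ * w⁻¹) * w) * w⁻¹ := by
    rw [e1]
  rw [e2, conj_pow, ← h, mul_one, mul_inv_cancel]

lemma orderOf_dvd_of_hmax {G : Type*} [Group G] [Finite G] (n : ℕ) (hn : Nat.card G = 3 ^ (n + 4))
    (hmax : ∀ M : Subgroup G, IsCoatom M → ¬ IsCyclic M) (g : G) : g ^ 3 ^ (n + 2) = 1 := by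
  by_contra hg
  obtain ⟨m, hm, hgm⟩ := (Nat.dvd_prime_pow Nat.prime_three).1 (hn ▸ orderOf_dvd_natCard g)
  have hm2 : n + 2 < m := by
    by_contra h
    apply hg
    rw [← orderOf_dvd_iff_pow_eq_one, hgm]
    exact pow_dvd_pow _ (by omega)
  have hcard : Nat.card (zpowers g) = 3 ^ m := by rw [Nat.card_zpowers, hgm]
  have hnt : Nontrivial G := by
    rw [← Finite.one_lt_card_iff_nontrivial, hn]
    exact Nat.one_lt_pow (by omega) (by norm_num)
  rcases eq_top_or_exists_le_coatom (zpowers g) with h | ⟨M, hM, hle⟩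
  · obtain ⟨M, hM, -⟩ := (eq_top_or_exists_le_coatom (⊥ : Subgroup G)).resolve_left bot_ne_top
    have : IsCyclic G := by
      refine ⟨g, fun x => ?_⟩
      have hx : x ∈ zpowers g := by rw [h]; exact mem_top x
      exact hx
    exact hmax M hM inferInstance
  · obtain ⟨j, hj, hMj⟩ := (Nat.dvd_prime_pow Nat.prime_three).1 (hn ▸ Subgroup.card_subgroup_dvd_card M)
    have hjn : j ≠ n + 4 := by
      rintro rfl
      exact hM.1 (Subgroup.eq_top_of_card_eq M (by rw [hMj, hn]))
    have hjm : 3 ^ j ≤ 3 ^ m := Nat.pow_le_pow_right (by norm_num) (by omega)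
    have : zpowers g = M := Subgroup.eq_of_le_of_card_ge hle (by rw [hMj, hcard]; exact hjm)
    exact hmax M hM (this ▸ inferInstance)

/-- Let `G` be a finite 3-group of order greater than 27 all of whose maximal
subgroups are noncyclic.  Then `G` has a normal subgroup `H ≅ C₃ × C₃` such that
`G/H` is not cyclic. -/
theorem normal_C3xC3_exists
    {G : Type*} [Group G] [Fintype G]
    (hG : ∃ n : ℕ, Fintype.card G = 3 ^ n)
    (hcard : 27 < Fintype.card G)
    (hmax : ∀ M : Subgroup G, IsCoatom M → ¬ IsCyclic M) :
    ∃ (H : Subgroup G) (hn : H.Normal),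
      Nonempty (H ≃* Multiplicative (ZMod 3 × ZMod 3)) ∧
      QuotientNotCyclic H hn := by
  obtain ⟨n', hn'⟩ := hG
  have hn4 : 4 ≤ n' := by
    by_contra h
    have : 3 ^ n' ≤ 3 ^ 3 := Nat.pow_le_pow_right (by norm_num) (by omega)
    omega
  obtain ⟨n, rfl⟩ := Nat.exists_eq_add_of_le' hn4
  have hc : Nat.card G = 3 ^ (n + 4) := by rw [Nat.card_eq_fintype_card, hn']
  have hP : IsPGroup 3 G := IsPGroup.of_card hc
  have hexp := orderOf_dvd_of_hmax n hc hmax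
  have hpos : 0 < 3 ^ (n + 2) := by positivity
  have hncyc : ¬ IsCyclic G := by
    intro h
    obtain ⟨g, hg⟩ := h.exists_ofOrder_eq_natCard
    have h1 := orderOf_dvd_of_pow_eq_one (hexp g)
    rw [hg, hc, Nat.pow_dvd_pow_iff_le_right (by norm_num)] at h1
    omega
  have hcard9 : ∀ K : Subgroup G, Nonempty (K ≃* Multiplicative (ZMod 3 × ZMod 3)) →
      Nat.card (G ⧸ K) = 3 ^ (n + 2) := by
    rintro K ⟨e⟩
    have h9 : Nat.card K = 9 := by
      rw [Nat.card_congr e.toEquiv, Nat.card_congr Multiplicative.toAdd, Nat.card_prod]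
      simp
    have := Subgroup.card_eq_card_quotient_mul_card_subgroup K
    rw [hc, h9] at this
    have e' : 3 ^ (n + 4) = 3 ^ (n + 2) * 9 := by ring
    rw [e'] at this
    omega
  obtain ⟨h, w, hhc, hh3, hh1, hw3, hwh, hwg⟩ := exists_gens hP hncyc
  set H := closure ({h, w} : Set G) with hH
  have hhH : h ∈ H := subset_closure (by simp)
  have hwH : w ∈ H := subset_closure (by simp)
  have hzH : zpowers h ≤ H := by rwa [zpowers_le]
  have hHn : H.Normal := by
    refine ⟨fun t ht g => ?_⟩
    have hle : H ≤ H.comap (MulAut.conj g).toMonoidHom := by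
      rw [hH, closure_le, ← hH]
      rintro t (rfl | rfl)
      · change g * t * g⁻¹ ∈ H
        rw [mem_center_iff.1 hhc g]
        simpa using hhH
      · change g * t * g⁻¹ ∈ H
        have := mul_mem (hzH (hwg g)) hwH
        simpa using this
    exact hle ht
  have hHe := closure_pair_equiv h w (mem_center_iff.1 hhc w).symm hh3 hw3 hh1 hwh
  rw [← hH] at hHe
  by_cases hHc : QuotientNotCyclic H hHn
  · exact ⟨H, hHn, hHe, hHc⟩
  have hHc' : IsCyclic (G ⧸ H) := by
    by_contra hh
    exact hHc hh
  obtain ⟨xb, hxb⟩ := hHc'.exists_generator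
  obtain ⟨x, rfl⟩ := QuotientGroup.mk_surjective xb
  have hox : orderOf (x : G ⧸ H) = 3 ^ (n + 2) := by
    rw [orderOf_eq_card_of_forall_mem_zpowers hxb, hcard9 H hHe]
  have hdec : ∀ g : G, ∃ u ∈ H, ∃ i : ℤ, g = u * x ^ i := by
    intro g
    obtain ⟨i, hi⟩ := mem_zpowers_iff.1 (hxb (g : G ⧸ H))
    refine ⟨g * (x ^ i)⁻¹, ?_, i, by simp⟩
    rw [← QuotientGroup.eq_one_iff]
    change (g : G ⧸ H) * ((x : G ⧸ H) ^ i)⁻¹ = 1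
    rw [hi, mul_inv_cancel]
  -- the cube of x is central
  have hx3w : w * x ^ 3 = x ^ 3 * w := by
    obtain ⟨i, hi⟩ := mem_zpowers_iff.1 (hwg x)
    have hcz : ∀ g, Commute g (h ^ i) := fun g => mem_center_iff.1 (zpow_mem hhc i) g
    have h1 : x * w = h ^ i * w * x := by rw [hi]; group
    have h3 : h ^ i * h ^ i * h ^ i = 1 := by
      rw [← zpow_add, ← zpow_add, ← mul_one (i + i + i)]
      have : (i + i + i) * 1 = (3 : ℕ) * i := by push_cast; ring
      rw [this, zpow_mul, zpow_natCast, hh3, one_zpow]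
    symm
    generalize h ^ i = c at *
    have hx := (hcz x).eq
    calc x ^ 3 * w = x * (x * (x * w)) := by simp only [pow_succ, pow_zero, one_mul, mul_assoc]
      _ = x * ((x * c) * w * x) := by rw [h1]; simp only [mul_assoc]
      _ = x * (c * (x * w) * x) := by rw [hx]; simp only [mul_assoc]
      _ = (x * c) * c * w * x * x := by rw [h1]; simp only [mul_assoc]
      _ = c * (x * c) * w * x * x := by rw [hx, mul_assoc c x c, hx]
      _ = c * c * (x * w) * x * x := by rw [hx]; simp only [mul_assoc]
      _ = (c * c * c) * w * (x * x * x) := by rw [h1]; simp only [mul_assoc]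
      _ = w * x ^ 3 := by rw [h3]; simp only [pow_succ, pow_zero, one_mul, mul_assoc]
  have hx3c : x ^ 3 ∈ center G := by
    rw [mem_center_iff]
    intro g
    have hHle : H ≤ centralizer {x ^ 3} := by
      rw [hH, closure_le]
      rintro t (rfl | rfl)
      · exact mem_centralizer_singleton_iff.2 (mem_center_iff.1 hhc _).symm
      · exact mem_centralizer_singleton_iff.2 hx3w
    have hxc : x ∈ centralizer {x ^ 3} := mem_centralizer_singleton_iff.2 (by group)
    obtain ⟨u, hu, i, rfl⟩ := hdec g
    exact mem_centralizer_singleton_iff.1 (mul_mem (hHle hu) (zpow_mem hxc i))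
  obtain ⟨z, hz⟩ : ∃ z, z = x ^ 3 ^ (n + 1) := ⟨_, rfl⟩
  have hzc : z ∈ center G := by
    rw [hz, pow_succ', pow_mul]
    exact pow_mem hx3c _
  have hz3 : z ^ 3 = 1 := by
    rw [hz, ← pow_mul, ← pow_succ]
    exact hexp x
  have hzH' : z ∉ H := by
    intro hzm
    rw [← QuotientGroup.eq_one_iff, hz] at hzm
    have h1 : (x : G ⧸ H) ^ 3 ^ (n + 1) = 1 := hzm
    have h2 := orderOf_dvd_of_pow_eq_one h1
    rw [hox, Nat.pow_dvd_pow_iff_le_right (by norm_num)] at h2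
    omega
  have hKe := closure_pair_equiv h z (mem_center_iff.1 hzc h) hh3 hz3 hh1 (fun hm => hzH' (hzH hm))
  set K := closure ({h, z} : Set G) with hK
  have hKc : K ≤ center G := by
    rw [hK, closure_le]
    rintro t (rfl | rfl)
    · exact hhc
    · exact hzc
  have hzK : z ∈ K := subset_closure (by simp)
  have hKn : K.Normal := by
    refine ⟨fun t ht g => ?_⟩
    rw [mem_center_iff.1 (hKc ht) g]
    simpa using ht
  refine ⟨K, hKn, hKe, ?_⟩
  intro hcyc
  have hcyc' : IsCyclic (G ⧸ K) := hcyc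
  have hcomm : ∀ a b : G, a * b = b * a :=
    commutative_of_cyclic_center_quotient (QuotientGroup.mk' K) (by
      rw [QuotientGroup.ker_mk']; exact hKc)
  have hH3 : ∀ u ∈ H, u ^ 3 = 1 := by
    intro u hu
    induction hu using closure_induction with
    | mem t ht =>
      rcases ht with rfl | rfl
      · exact hh3
      · exact hw3
    | one => simp
    | mul a b _ _ ha hb =>
      have : Commute a b := hcomm a b
      rw [this.mul_pow, ha, hb, one_mul]
    | inv a _ ha => rw [inv_pow, ha, inv_one]
  obtain ⟨gb, hgb⟩ := hcyc'.exists_ofOrder_eq_natCard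
  obtain ⟨g, rfl⟩ := QuotientGroup.mk_surjective gb
  rw [hcard9 K hKe] at hgb
  have hgK : g ^ 3 ^ (n + 1) ∈ K := by
    obtain ⟨u, hu, i, rfl⟩ := hdec g
    have hco : Commute u (x ^ i) := hcomm _ _
    rw [hco.mul_pow]
    have h1 : u ^ 3 ^ (n + 1) = 1 := by rw [pow_succ', pow_mul, hH3 u hu, one_pow]
    have h2 : (x ^ i) ^ 3 ^ (n + 1) = z ^ i := by
      rw [hz, ← zpow_natCast, ← zpow_natCast, zpow_comm]
    rw [h1, h2, one_mul]
    exact zpow_mem hzK i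
  have h1 : (g : G ⧸ K) ^ 3 ^ (n + 1) = 1 := (QuotientGroup.eq_one_iff _).2 hgK
  have h2 := orderOf_dvd_of_pow_eq_one h1
  rw [hgb, Nat.pow_dvd_pow_iff_le_right (by norm_num)] at h2
  omega
end
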